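/- arXiv:1905.02309 — 3 statements merged into one kernel-verified Lean document; each statement's English description precedes it below -/
import Mathlib

section
/- For all integers s ≥ 1, N_{s,3}(2143)(q) = q^{9·binomial(s,2)}·F_s(1/q); equivalently, if F_s(r) = Σ_k c_k r^k, then N_{s,3}(2143)(q) = Σ_k c_k q^{9s(s−1)/2 − k} as polynomials in q. -/
open Polynomial

/-- `σ ∈ S_n` contains the pattern `τ ∈ S_m`. -/
def PermContains {n m : ℕ} (σ : Equiv.Perm (Fin n)) (τ : Equiv.Perm (Fin m)) : Prop :=
  ∃ f : Fin m → Fin n, StrictMono f ∧ ∀ j k : Fin m, σ (f j) < σ (f k) ↔ τ j < τ k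

/-- The pattern `1243` (0-indexed). -/
def pat1243 : Equiv.Perm (Fin 4) := ⟨![0, 1, 3, 2], ![0, 1, 3, 2], by decide, by decide⟩

/-- The pattern `2143` (0-indexed). -/
def pat2143 : Equiv.Perm (Fin 4) := ⟨![1, 0, 3, 2], ![1, 0, 3, 2], by decide, by decide⟩

/-- `w ∈ S_{st}` (a word recorded as a permutation of `Fin (s*t)`, positions and labels both
0-indexed, 0-indexed label `a` standing for the poset label `a+1`) encodes a linear extension
of the rectangular poset `N_{s,t}`: for every label `a ∈ [st]`, if `t ∤ a` then `a` appears
before `a+1`, and if `a > t` then `a` appears before `a−t`.  ("`a` appears before `b`" means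
`w.symm a < w.symm b`.) -/
def IsLinExtN (s t : ℕ) (w : Equiv.Perm (Fin (s * t))) : Prop :=
  (∀ a b : Fin (s * t), (b : ℕ) = (a : ℕ) + 1 → ¬ (t ∣ ((a : ℕ) + 1)) →
      w.symm a < w.symm b) ∧
  (∀ a b : Fin (s * t), (b : ℕ) + t = (a : ℕ) → w.symm a < w.symm b)

/-- The number of inversions of `w`. -/
def invCount {n : ℕ} (w : Equiv.Perm (Fin n)) : ℕ :=
  (Finset.univ.filter fun p : Fin n × Fin n => p.1 < p.2 ∧ w p.2 < w p.1).card

open Classical in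
/-- The polynomial `N_{s,t}(τ)(q) = Σ_{w ∈ N_{s,t}(τ)} q^{inv(w)}`. -/
noncomputable def NPoly (s t : ℕ) {m : ℕ} (τ : Equiv.Perm (Fin m)) : Polynomial ℤ :=
  ∑ w ∈ Finset.univ.filter
      (fun w : Equiv.Perm (Fin (s * t)) => IsLinExtN s t w ∧ ¬ PermContains w τ),
    (X : Polynomial ℤ) ^ invCount w

/-- The polynomials `F_s`: `F_0 = F_1 = 1`, `F_s = (1+r+2r²)F_{s−1} + r³F_{s−2}`. -/
noncomputable def Fpoly : ℕ → Polynomial ℤ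
  | 0 => 1
  | 1 => 1
  | s + 2 => (1 + X + 2 * X ^ 2) * Fpoly (s + 1) + X ^ 3 * Fpoly s

/-- The number of elements of the lower row preceding the `j`-th element of the upper row, for
each of the five ways `t` of interleaving two adjacent rows of length three. -/
def lowerBefore (t : Fin 5) (j : Fin 3) : ℕ :=
  ![![0, 0, 0], ![0, 0, 1], ![0, 0, 2], ![0, 1, 1], ![0, 1, 2]] t j

/-- The number of elements of the upper row following the `l`-th element of the lower row. -/
def upperAfter (t : Fin 5) (l : Fin 3) : ℕ :=
  ![![0, 0, 0], ![1, 0, 0], ![1, 1, 0], ![2, 0, 0], ![2, 1, 0]] t l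

/-- The number of pairs of an element of the upper row following one of the lower row. -/
def crossings (t : Fin 5) : ℕ := lowerBefore t 1 + lowerBefore t 2

/-- Two consecutive interleavings `t` (of rows `0, 1`) and `t'` (of rows `1, 2`) leave room for
row `2` to precede row `0`. -/
def Fits (t t' : Fin 5) : Prop := ¬ (lowerBefore t 1 = 1 ∧ lowerBefore t' 2 = 2)

instance (t t' : Fin 5) : Decidable (Fits t t') := inferInstanceAs (Decidable (¬ _))

/-- A sequence of interleavings, padded by trivial ones on both sides. -/
def padded {n : ℕ} (T : Fin n → Fin 5) : ℕ → Fin 5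
  | 0 => 0
  | g + 1 => if h : g < n then T ⟨g, h⟩ else 0

/-- Any two consecutive interleavings fit. -/
def Compatible {n : ℕ} (T : Fin n → Fin 5) : Prop := ∀ g, Fits (padded T g) (padded T (g + 1))

/-- The order conditions on the positions `p g j` of the elements of the rows. -/
structure RowOrdered {n : ℕ} {α : Type*} [LinearOrder α] (p : Fin (n + 1) → Fin 3 → α) :
    Prop where
  row : ∀ g, StrictMono (p g)
  col : ∀ (i : Fin n) j, p i.succ j < p i.castSucc j
  far : ∀ g h : Fin (n + 1), (g : ℕ) + 2 = h → p h 2 < p g 0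

/-- Adjacent rows are interleaved by `p` as prescribed by `T`. -/
def Linked {n : ℕ} {α : Type*} [LinearOrder α] (p : Fin (n + 1) → Fin 3 → α)
    (T : Fin n → Fin 5) : Prop :=
  ∀ i l j, p i.castSucc l < p i.succ j ↔ (l : ℕ) < lowerBefore (T i) j

section Rows

variable {n : ℕ} {α β : Type*} [LinearOrder α] [LinearOrder β]
  {p : Fin (n + 1) → Fin 3 → α} {p' : Fin (n + 1) → Fin 3 → β} {T T' : Fin n → Fin 5}

lemma RowOrdered.lt_of_add_two_le (hp : RowOrdered p) {g h : Fin (n + 1)}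
    (hgh : (g : ℕ) + 2 ≤ h) (l j : Fin 3) : p h j < p g l := by
  have hanti : StrictAnti fun i => p i 2 := Fin.strictAnti_iff_succ_lt.2 fun i => hp.col i 2
  have hlt : (g : ℕ) + 2 < n + 1 := by omega
  calc p h j ≤ p h 2 := (hp.row h).monotone (Fin.le_last j)
    _ ≤ p ⟨g + 2, hlt⟩ 2 := hanti.antitone hgh
    _ < p g 0 := hp.far _ _ rfl
    _ ≤ p g l := (hp.row g).monotone (Fin.zero_le l)

lemma eq_castSucc_succ {g h : Fin (n + 1)} (hgh : (h : ℕ) = g + 1) :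
    ∃ i : Fin n, g = i.castSucc ∧ h = i.succ :=
  ⟨⟨g, by omega⟩, rfl, Fin.ext hgh⟩

lemma RowOrdered.lt_of_lt (hp : RowOrdered p) (hp' : RowOrdered p') (hT : Linked p T)
    (hT' : Linked p' T) (hinj : Function.Injective2 p') {g h : Fin (n + 1)} {l j : Fin 3}
    (hlt : p g l < p h j) : p' g l < p' h j := by
  rcases lt_trichotomy g h with hgh | rfl | hgh
  · by_cases hh : (h : ℕ) = g + 1
    · obtain ⟨i, rfl, rfl⟩ := eq_castSucc_succ hh
      exact (hT' _ _ _).2 ((hT _ _ _).1 hlt)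
    · exact absurd hlt (hp.lt_of_add_two_le (by omega) _ _).not_gt
  · exact hp'.row _ ((hp.row _).lt_iff_lt.1 hlt)
  · by_cases hh : (g : ℕ) = h + 1
    · obtain ⟨i, rfl, rfl⟩ := eq_castSucc_succ hh
      refine lt_of_le_of_ne (not_lt.1 fun hc => ?_) fun he => hgh.ne' (hinj he).1
      exact hlt.not_gt ((hT _ _ _).2 ((hT' _ _ _).1 hc))
    · exact hp'.lt_of_add_two_le (by omega) _ _

lemma Linked.unique (hT : Linked p T) (hT' : Linked p T') : T = T' := by
  have key : ∀ t t' : Fin 5,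
      (∀ l j : Fin 3, (l : ℕ) < lowerBefore t j ↔ (l : ℕ) < lowerBefore t' j) → t = t' := by
    decide
  exact funext fun i => key _ _ fun l j => (hT i l j).symm.trans (hT' i l j)

lemma exists_lowerBefore {a b : Fin 3 → α} (ha : StrictMono a) (hb : StrictMono b)
    (hab : ∀ j, a j < b j) :
    ∃ t, ∀ l j, b l < a j ↔ (l : ℕ) < lowerBefore t j := by
  have a1 := ha (show (0 : Fin 3) < 1 by decide)
  have a2 := ha (show (1 : Fin 3) < 2 by decide)
  have b1 := hb (show (0 : Fin 3) < 1 by decide)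
  have b2 := hb (show (1 : Fin 3) < 2 by decide)
  have h0 := hab 0
  have h1 := hab 1
  have h2 := hab 2
  have n1 : ¬ b 0 < a 0 := h0.not_gt
  have n2 : ¬ b 1 < a 0 := (h0.trans b1).not_gt
  have n3 : ¬ b 2 < a 0 := (h0.trans (b1.trans b2)).not_gt
  have n4 : ¬ b 1 < a 1 := h1.not_gt
  have n5 : ¬ b 2 < a 1 := (h1.trans b2).not_gt
  have n6 : ¬ b 2 < a 2 := h2.not_gt
  by_cases c1 : b 0 < a 1
  · have c2 : b 0 < a 2 := c1.trans a2
    by_cases c3 : b 1 < a 2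
    · refine ⟨4, fun l j => ?_⟩
      fin_cases l <;> fin_cases j <;> simp [lowerBefore, *]
    · refine ⟨3, fun l j => ?_⟩
      fin_cases l <;> fin_cases j <;> simp [lowerBefore, *]
  · by_cases c3 : b 1 < a 2
    · have c2 : b 0 < a 2 := b1.trans c3
      refine ⟨2, fun l j => ?_⟩
      fin_cases l <;> fin_cases j <;> simp [lowerBefore, *]
    · by_cases c2 : b 0 < a 2
      · refine ⟨1, fun l j => ?_⟩
        fin_cases l <;> fin_cases j <;> simp [lowerBefore, *]
      · refine ⟨0, fun l j => ?_⟩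
        fin_cases l <;> fin_cases j <;> simp [lowerBefore, *]

lemma RowOrdered.exists_linked (hp : RowOrdered p) : ∃ T, Compatible T ∧ Linked p T := by
  choose T hT using fun i : Fin n =>
    exists_lowerBefore (hp.row i.succ) (hp.row i.castSucc) (hp.col i)
  refine ⟨T, ?_, hT⟩
  rintro (_ | g) ⟨h1, h2⟩
  · simp [padded, lowerBefore] at h1
  · by_cases hg : g + 1 < n
    · have hg' : g < n := by omega
      simp only [padded, hg, hg', dif_pos] at h1 h2
      have e1 := (hT ⟨g, hg'⟩ 0 1).2 (by simp [h1])
      have e2 := (hT ⟨g + 1, hg⟩ 1 2).2 (by simp [h2])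
      exact (e1.trans e2).not_gt (hp.far _ _ rfl)
    · simp [padded, hg, lowerBefore] at h2

end Rows

/-- The position (up to a shift) of the `j`-th element of row `g` in the word in which adjacent
rows are interleaved as prescribed by `x`. -/
def rowPosition (x : ℕ → Fin 5) (g : ℕ) (j : Fin 3) : ℤ :=
  -3 * g + j + lowerBefore (x g) j - upperAfter (x (g + 1)) j

section Position

variable {n : ℕ} {T : Fin n → Fin 5}

lemma rowPosition_strictMono (x : ℕ → Fin 5) (g : ℕ) : StrictMono (rowPosition x g) := by
  have key : ∀ (a b : Fin 5) (j l : Fin 3), j < l →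
      (j : ℕ) + lowerBefore a j + upperAfter b l < l + lowerBefore a l + upperAfter b j := by
    decide
  intro j l hjl
  have := key (x g) (x (g + 1)) j l hjl
  unfold rowPosition
  omega

lemma rowPosition_adjacent {x : ℕ → Fin 5} {g : ℕ} (h1 : Fits (x g) (x (g + 1)))
    (h2 : Fits (x (g + 1)) (x (g + 2))) (l j : Fin 3) :
    (rowPosition x g l < rowPosition x (g + 1) j ↔ (l : ℕ) < lowerBefore (x (g + 1)) j) ∧
      rowPosition x g l ≠ rowPosition x (g + 1) j := by
  have key : ∀ a b : Fin 5, Fits a b → ∀ c, Fits b c → ∀ l j : Fin 3,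
      ((l : ℕ) + lowerBefore a l + upperAfter c j + 3 < j + lowerBefore b j + upperAfter b l ↔
        (l : ℕ) < lowerBefore b j) ∧
      (l : ℕ) + lowerBefore a l + upperAfter c j + 3 ≠ j + lowerBefore b j + upperAfter b l := by
    decide +kernel
  have := key _ _ h1 _ h2 l j
  rw [← this.1]
  have h3 := this.2
  unfold rowPosition
  rw [show g + 1 + 1 = g + 2 from rfl]
  push_cast
  constructor
  · constructor <;> intro <;> omega
  · omega

lemma rowPosition_far {x : ℕ → Fin 5} {g : ℕ} (h : Fits (x (g + 1)) (x (g + 2))) :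
    rowPosition x (g + 2) 2 < rowPosition x g 0 := by
  have key : ∀ a b c d : Fin 5, Fits b c →
      2 + lowerBefore c 2 + upperAfter b 0 < 6 + lowerBefore a 0 + upperAfter d 2 := by
    decide +kernel
  have := key (x g) (x (g + 1)) (x (g + 2)) (x (g + 3)) h
  unfold rowPosition
  rw [show g + 2 + 1 = g + 3 from rfl]
  push_cast
  simp only [Fin.val_zero, Fin.val_two]
  push_cast
  omega

lemma padded_succ (T : Fin n → Fin 5) (i : Fin n) : padded T (i + 1) = T i := by
  simp [padded]

lemma linked_rowPosition (hT : Compatible T) :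
    Linked (fun g : Fin (n + 1) => rowPosition (padded T) g) T := by
  intro i l j
  have := (rowPosition_adjacent (hT i) (hT (i + 1)) l j).1
  rwa [padded_succ] at this

lemma rowOrdered_rowPosition (hT : Compatible T) :
    RowOrdered (fun g : Fin (n + 1) => rowPosition (padded T) g) where
  row g := rowPosition_strictMono _ _
  col i j := by
    obtain ⟨h1, h2⟩ := rowPosition_adjacent (hT i) (hT (i + 1)) j j
    have key : ∀ (t : Fin 5) (j : Fin 3), lowerBefore t j ≤ j := by decide
    exact lt_of_le_of_ne (not_lt.1 fun hc => (h1.1 hc).not_ge (key _ _)) h2.symm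
  far g h hgh := by
    simp only [← hgh]
    exact rowPosition_far (hT _)

lemma injective2_rowPosition (hT : Compatible T) :
    Function.Injective2 (fun g : Fin (n + 1) => rowPosition (padded T) g) := by
  have hp := rowOrdered_rowPosition hT
  intro g h l j he
  wlog hgh : g ≤ h generalizing g h l j
  · have := this he.symm (le_of_not_ge hgh)
    exact ⟨this.1.symm, this.2.symm⟩
  rcases hgh.lt_or_eq with hlt | rfl
  · exfalso
    by_cases hh : (h : ℕ) = g + 1
    · obtain ⟨i, rfl, rfl⟩ := eq_castSucc_succ hh
      exact (rowPosition_adjacent (hT i) (hT (i + 1)) l j).2 he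
    · exact (hp.lt_of_add_two_le (g := g) (h := h) (by omega) l j).ne' he
  · exact ⟨rfl, (hp.row g).injective he⟩

end Position

/-- The position in the word `w` of the `j`-th element of row `g`. -/
def wordPosition {s : ℕ} (w : Equiv.Perm (Fin (s * 3))) (g : Fin s) (j : Fin 3) : Fin (s * 3) :=
  w.symm (finProdFinEquiv (g, j))

section Words

variable {n : ℕ} {w : Equiv.Perm (Fin ((n + 1) * 3))} {T : Fin n → Fin 5}

lemma injective2_wordPosition {s : ℕ} (w : Equiv.Perm (Fin (s * 3))) :
    Function.Injective2 (wordPosition w) := by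
  intro g h l j he
  simpa [wordPosition] using he

lemma isLinExtN_three_iff : IsLinExtN (n + 1) 3 w ↔
    (∀ g, StrictMono (wordPosition w g)) ∧
      ∀ (i : Fin n) j, wordPosition w i.succ j < wordPosition w i.castSucc j := by
  constructor
  · rintro ⟨h1, h2⟩
    refine ⟨fun g => Fin.strictMono_iff_lt_succ.2 fun j => h1 _ _ ?_ ?_, fun i j => h2 _ _ ?_⟩
    · simp [finProdFinEquiv]; omega
    · simp [finProdFinEquiv]; omega
    · simp [finProdFinEquiv]; omega
  · rintro ⟨h1, h2⟩
    constructor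
    · intro a b hab ha
      obtain ⟨⟨g, l⟩, rfl⟩ := finProdFinEquiv.surjective a
      obtain ⟨⟨h, j⟩, rfl⟩ := finProdFinEquiv.surjective b
      simp only [finProdFinEquiv, Equiv.coe_fn_mk] at hab ha
      obtain rfl : g = h := Fin.ext (by omega)
      exact h1 g (show (l : ℕ) < j by omega)
    · intro a b hab
      obtain ⟨⟨g, l⟩, rfl⟩ := finProdFinEquiv.surjective a
      obtain ⟨⟨h, j⟩, rfl⟩ := finProdFinEquiv.surjective b
      simp only [finProdFinEquiv, Equiv.coe_fn_mk] at hab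
      obtain rfl : l = j := Fin.ext (by omega)
      obtain ⟨i, rfl, rfl⟩ := eq_castSucc_succ (show (g : ℕ) = h + 1 by omega)
      exact h2 i l

lemma permContains_pat2143 {m : ℕ} {w : Equiv.Perm (Fin m)} {a b c d : Fin m} (hab : a < b)
    (hbc : b < c) (hcd : c < d) (h1 : w.symm b < w.symm a) (h2 : w.symm a < w.symm d)
    (h3 : w.symm d < w.symm c) : PermContains w pat2143 := by
  refine ⟨![w.symm b, w.symm a, w.symm d, w.symm c], Fin.strictMono_iff_lt_succ.2 fun i => ?_,
    fun j k => ?_⟩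
  · fin_cases i <;> simpa
  · have hac := hab.trans hbc
    have hbd := hbc.trans hcd
    have had := hac.trans hcd
    fin_cases j <;> fin_cases k <;>
      simp [pat2143, *, LT.lt.le]

lemma isLinExtN_and_not_permContains_iff :
    (IsLinExtN (n + 1) 3 w ∧ ¬ PermContains w pat2143) ↔ RowOrdered (wordPosition w) := by
  rw [isLinExtN_three_iff]
  constructor
  · rintro ⟨⟨h1, h2⟩, h3⟩
    refine ⟨h1, h2, fun g h hgh => ?_⟩
    by_contra hc
    have hlt : wordPosition w g 0 < wordPosition w h 2 := by
      refine lt_of_le_of_ne (not_lt.1 hc) fun he => ?_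
      have := (injective2_wordPosition w he).1
      subst this
      omega
    obtain ⟨i, rfl, -⟩ := eq_castSucc_succ
      (show ((⟨g + 1, by omega⟩ : Fin (n + 1)) : ℕ) = g + 1 from rfl)
    obtain ⟨k, e, rfl⟩ := eq_castSucc_succ (show (h : ℕ) = i.succ + 1 by simp [← hgh])
    refine h3 (permContains_pat2143 (a := finProdFinEquiv (i.castSucc, 0))
      (b := finProdFinEquiv (i.succ, 0)) (c := finProdFinEquiv (i.succ, 2))
      (d := finProdFinEquiv (k.succ, 2)) ?_ ?_ ?_ (h2 i 0) hlt ?_)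
    · simp [finProdFinEquiv, Fin.lt_def]
    · simp [finProdFinEquiv, Fin.lt_def]
    · simp [finProdFinEquiv, Fin.lt_def, e]
    · rw [e]
      exact h2 k 2
  · intro hp
    refine ⟨⟨hp.row, hp.col⟩, ?_⟩
    rintro ⟨f, hf, hw⟩
    have f01 : f 0 < f 1 := hf (by decide)
    have f12 : f 1 < f 2 := hf (by decide)
    have f23 : f 2 < f 3 := hf (by decide)
    have w10 : w (f 1) < w (f 0) := (hw 1 0).2 (by decide)
    have w03 : w (f 0) < w (f 3) := (hw 0 3).2 (by decide)
    have w32 : w (f 3) < w (f 2) := (hw 3 2).2 (by decide)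
    have hpos : ∀ x, ∃ g j, x = wordPosition w g j ∧ (w x : ℕ) = j + 3 * g := by
      intro x
      obtain ⟨⟨g, j⟩, hgj⟩ := finProdFinEquiv.surjective (w x)
      refine ⟨g, j, ?_, ?_⟩
      · simp [wordPosition, hgj]
      · rw [← hgj]; rfl
    obtain ⟨g0, j0, e0, v0⟩ := hpos (f 0)
    obtain ⟨g1, j1, e1, v1⟩ := hpos (f 1)
    obtain ⟨g2, j2, e2, v2⟩ := hpos (f 2)
    obtain ⟨g3, j3, e3, v3⟩ := hpos (f 3)
    rw [Fin.lt_def] at w10 w03 w32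
    have ne10 : g1 ≠ g0 := by
      rintro rfl
      rw [e0, e1] at f01
      have := Fin.lt_def.1 ((hp.row _).lt_iff_lt.1 f01)
      omega
    have ne32 : g3 ≠ g2 := by
      rintro rfl
      rw [e2, e3] at f23
      have := Fin.lt_def.1 ((hp.row _).lt_iff_lt.1 f23)
      omega
    rw [e1, e2] at f12
    refine f12.not_gt (hp.lt_of_add_two_le ?_ _ _)
    have := Fin.val_ne_of_ne ne10
    have := Fin.val_ne_of_ne ne32
    omega

/-- The word in which adjacent rows are interleaved as prescribed by `T`. -/
def wordOf (T : Fin n → Fin 5) : Equiv.Perm (Fin ((n + 1) * 3)) :=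
  Tuple.sort fun a => rowPosition (padded T) (finProdFinEquiv.symm a).1 (finProdFinEquiv.symm a).2

lemma wordPosition_wordOf_lt_iff (hT : Compatible T) {g h : Fin (n + 1)} {l j : Fin 3} :
    wordPosition (wordOf T) g l < wordPosition (wordOf T) h j ↔
      rowPosition (padded T) g l < rowPosition (padded T) h j := by
  set f : Fin ((n + 1) * 3) → ℤ := fun a =>
    rowPosition (padded T) (finProdFinEquiv.symm a).1 (finProdFinEquiv.symm a).2 with hf
  have hinj : Function.Injective f := fun a b hab => by
    have := injective2_rowPosition hT hab
    exact finProdFinEquiv.symm.injective (Prod.ext this.1 this.2)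
  have hmono : StrictMono (f ∘ wordOf T) :=
    (Tuple.monotone_sort f).strictMono_of_injective (hinj.comp (wordOf T).injective)
  rw [← hmono.lt_iff_lt]
  simp only [wordPosition, hf, Function.comp_apply, Equiv.apply_symm_apply,
    Equiv.symm_apply_apply]

lemma linked_wordOf (hT : Compatible T) : Linked (wordPosition (wordOf T)) T := fun i l j =>
  (wordPosition_wordOf_lt_iff hT).trans (linked_rowPosition hT i l j)

lemma rowOrdered_wordOf (hT : Compatible T) : RowOrdered (wordPosition (wordOf T)) where
  row g _ _ hjl := (wordPosition_wordOf_lt_iff hT).2 ((rowOrdered_rowPosition hT).row g hjl)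
  col i j := (wordPosition_wordOf_lt_iff hT).2 ((rowOrdered_rowPosition hT).col i j)
  far g h hgh := (wordPosition_wordOf_lt_iff hT).2 ((rowOrdered_rowPosition hT).far g h hgh)

lemma eq_of_wordPosition_lt {s : ℕ} {v w : Equiv.Perm (Fin (s * 3))}
    (h : ∀ g l i j, wordPosition v g l < wordPosition v i j →
      wordPosition w g l < wordPosition w i j) : v = w := by
  have hmono : StrictMono (w.symm ∘ v) := by
    intro x y hxy
    obtain ⟨⟨g, l⟩, hx⟩ := finProdFinEquiv.surjective (v x)
    obtain ⟨⟨i, j⟩, hy⟩ := finProdFinEquiv.surjective (v y)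
    have := h g l i j (by simpa [wordPosition, hx, hy] using hxy)
    simpa [wordPosition, hx, hy] using this
  have hid : w.symm ∘ v = id := (StrictMono.range_inj hmono strictMono_id).1
    (by simp [Set.range_comp])
  ext x
  have := congrFun hid x
  simp only [Function.comp_apply, id_eq, Equiv.symm_apply_eq] at this
  rw [this]

lemma exists_wordOf_eq (hp : RowOrdered (wordPosition w)) :
    ∃ T, Compatible T ∧ wordOf T = w := by
  obtain ⟨T, hT, hl⟩ := hp.exists_linked
  exact ⟨T, hT, eq_of_wordPosition_lt fun g l i j hlt =>
    (rowOrdered_wordOf hT).lt_of_lt hp (linked_wordOf hT) hl (injective2_wordPosition w) hlt⟩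

end Words

section Inversions

variable {n : ℕ} {w : Equiv.Perm (Fin ((n + 1) * 3))} {T : Fin n → Fin 5}

lemma invCount_eq_sum {s : ℕ} (w : Equiv.Perm (Fin (s * 3))) :
    invCount w = ∑ g, ∑ h, ∑ l, ∑ j,
      if wordPosition w h j < wordPosition w g l ∧ (l : ℕ) + 3 * g < j + 3 * h then 1 else 0 := by
  let e : (Fin s × Fin 3) ≃ Fin (s * 3) := finProdFinEquiv.trans w.symm
  have hcard : invCount w = ∑ y : Fin s × Fin 3, ∑ x : Fin s × Fin 3,
      if e x < e y ∧ w (e y) < w (e x) then 1 else 0 := by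
    rw [invCount, Finset.card_filter, Fintype.sum_prod_type_right,
      ← e.sum_comp (fun y => ∑ x, if x < y ∧ w y < w x then 1 else 0)]
    exact Finset.sum_congr rfl fun y _ =>
      (e.sum_comp (fun x => if x < e y ∧ w (e y) < w x then 1 else 0)).symm
  rw [hcard, Fintype.sum_prod_type]
  refine Finset.sum_congr rfl fun g _ => ?_
  simp_rw [Fintype.sum_prod_type]
  rw [Finset.sum_comm]
  refine Finset.sum_congr rfl fun h _ => Finset.sum_congr rfl fun l _ =>
    Finset.sum_congr rfl fun j _ => ?_
  simp only [e, wordPosition, Equiv.trans_apply, Equiv.apply_symm_apply]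
  rfl

lemma sum_adjacent (c : Fin n → ℕ) :
    ∑ g : Fin (n + 1), ∑ h : Fin (n + 1),
      (if hh : (h : ℕ) = g + 1 then c ⟨g, by omega⟩ else 0) = ∑ i, c i := by
  rw [Fin.sum_univ_castSucc]
  have hlast : ∑ h : Fin (n + 1),
      (if hh : (h : ℕ) = Fin.last n + 1 then c ⟨Fin.last n, by omega⟩ else 0) = 0 := by
    refine Finset.sum_eq_zero fun h _ => dif_neg ?_
    simp only [Fin.val_last]
    omega
  rw [hlast, add_zero]
  refine Finset.sum_congr rfl fun i _ => ?_
  rw [Finset.sum_eq_single i.succ]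
  · simp
  · intro h _ hh
    refine dif_neg fun hc => hh (Fin.ext ?_)
    simpa using hc
  · simp

lemma sum_lt_nine (s : ℕ) :
    ∑ g : Fin s, ∑ h : Fin s, (if g < h then 9 else 0) = 9 * s.choose 2 := by
  induction s with
  | zero => simp
  | succ s ih =>
    rw [Fin.sum_univ_castSucc]
    simp_rw [Fin.sum_univ_castSucc (n := s)]
    simp only [Fin.castSucc_lt_castSucc_iff, Fin.castSucc_lt_last, if_true, lt_irrefl, if_false,
      Finset.sum_add_distrib, ih, Fin.not_lt.2 (Fin.le_last _), Finset.sum_const_zero]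
    rw [Nat.choose_succ_succ' s 1]
    simp
    ring

lemma invCount_add_sum_crossings (hp : RowOrdered (wordPosition w))
    (hT : Linked (wordPosition w) T) :
    invCount w + ∑ i, crossings (T i) = 9 * (n + 1).choose 2 := by
  rw [invCount_eq_sum, ← sum_adjacent fun i => crossings (T i), ← sum_lt_nine, ← Finset.sum_add_distrib]
  refine Finset.sum_congr rfl fun g _ => ?_
  rw [← Finset.sum_add_distrib]
  refine Finset.sum_congr rfl fun h _ => ?_
  by_cases hgh : g < h
  · have hlab : ∀ l j : Fin 3, (l : ℕ) + 3 * g < j + 3 * h := by omega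
    simp only [hlab, and_true, hgh, if_true]
    by_cases hh : (h : ℕ) = g + 1
    · obtain ⟨i, rfl, rfl⟩ := eq_castSucc_succ hh
      have hiff : ∀ l j, wordPosition w i.succ j < wordPosition w i.castSucc l ↔
          ¬ (l : ℕ) < lowerBefore (T i) j := by
        intro l j
        rw [← hT, not_lt]
        refine ⟨le_of_lt, fun hle => lt_of_le_of_ne hle fun he => hgh.ne' ?_⟩
        exact (injective2_wordPosition w he).1
      have key : ∀ t : Fin 5, (∑ l : Fin 3, ∑ j : Fin 3,
          if ¬ (l : ℕ) < lowerBefore t j then 1 else 0) + crossings t = 9 := by decide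
      simp only [hiff]
      simpa using key (T i)
    · have hlt := fun l j => hp.lt_of_add_two_le (g := g) (h := h) (by omega) l j
      simp [hlt, hh]
  · have hh : ¬ (h : ℕ) = g + 1 := by omega
    have hno : ∀ l j : Fin 3, ¬ (wordPosition w h j < wordPosition w g l ∧
        (l : ℕ) + 3 * g < j + 3 * h) := by
      rintro l j ⟨hlt, hlab⟩
      obtain rfl : g = h := Fin.ext (by omega)
      have := Fin.lt_def.1 ((hp.row g).lt_iff_lt.1 hlt)
      omega
    simp [hno, hgh, hh]

end Inversions

section Transfer

open Classical in
/-- The generating polynomial of compatible sequences satisfying `P`, by crossings. -/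
noncomputable def seqPoly (n : ℕ) (P : Fin 5 → Prop) : ℤ[X] :=
  ∑ T : Fin n → Fin 5, if Compatible T ∧ P (padded T 1) then X ^ (∑ i, crossings (T i)) else 0

lemma compatible_cons_iff {n : ℕ} (t : Fin 5) (T : Fin n → Fin 5) :
    Compatible (Fin.cons t T : Fin (n + 1) → Fin 5) ↔ Compatible T ∧ Fits t (padded T 1) := by
  have h1 : padded (Fin.cons t T : Fin (n + 1) → Fin 5) 1 = t := rfl
  have h2 : ∀ g, padded (Fin.cons t T : Fin (n + 1) → Fin 5) (g + 2) = padded T (g + 1) := by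
    intro g
    by_cases hg : g < n
    · simp only [padded, hg, Nat.succ_lt_succ hg, dif_pos]
      rfl
    · simp [padded, hg]
  have h0 : ∀ t, Fits 0 t := by decide
  constructor
  · intro h
    refine ⟨?_, ?_⟩
    · rintro (_ | g)
      · exact h0 _
      · have := h (g + 2)
        rwa [h2 g, h2 (g + 1)] at this
    · have := h 1
      rwa [h1, h2 0] at this
  · rintro ⟨h, ht⟩ (_ | _ | g)
    · exact h0 _
    · show Fits (padded (Fin.cons t T : Fin (n + 1) → Fin 5) 1) _
      rw [h1, h2 0]
      exact ht
    · rw [h2 g, h2 (g + 1)]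
      exact h (g + 1)

open Classical in
lemma seqPoly_succ (n : ℕ) (P : Fin 5 → Prop) :
    seqPoly (n + 1) P = ∑ t, if P t then X ^ crossings t * seqPoly n (Fits t) else 0 := by
  rw [seqPoly, ← (Fin.consEquiv fun _ => Fin 5).sum_comp, Fintype.sum_prod_type]
  refine Finset.sum_congr rfl fun t _ => ?_
  have h1 : ∀ T : Fin n → Fin 5, padded (Fin.cons t T : Fin (n + 1) → Fin 5) 1 = t :=
    fun _ => rfl
  have h2 : ∀ T : Fin n → Fin 5, Fin.consEquiv (fun _ => Fin 5) (t, T) = Fin.cons t T :=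
    fun _ => rfl
  simp only [h2, compatible_cons_iff, h1, Fin.sum_univ_succ, Fin.cons_zero, Fin.cons_succ]
  by_cases hP : P t
  · simp [hP, seqPoly, Finset.mul_sum, pow_add]
  · simp [hP]

lemma seqPoly_add_not (n : ℕ) (P : Fin 5 → Prop) :
    seqPoly n P + seqPoly n (fun t => ¬ P t) = seqPoly n (fun _ => True) := by
  simp only [seqPoly, ← Finset.sum_add_distrib]
  refine Finset.sum_congr rfl fun T _ => ?_
  by_cases h1 : Compatible T <;> by_cases h2 : P (padded T 1) <;> simp [h1, h2]

lemma seqPoly_fits_of_eq_zero (n : ℕ) {t : Fin 5} (ht : lowerBefore t 1 = 0) :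
    seqPoly n (Fits t) = seqPoly n (fun _ => True) := by
  have h : Fits t = fun _ => True := by
    funext t'
    simp [Fits, ht]
  rw [h]

lemma seqPoly_fits_of_eq_one (n : ℕ) {t : Fin 5} (ht : lowerBefore t 1 = 1) :
    seqPoly n (Fits t) =
      seqPoly n (fun _ => True) - seqPoly n (fun t => lowerBefore t 2 = 2) := by
  have h : Fits t = fun t' => ¬ lowerBefore t' 2 = 2 := by
    funext t'
    simp [Fits, ht]
  rw [h, ← seqPoly_add_not n fun t => lowerBefore t 2 = 2, add_sub_cancel_left]

lemma seqPoly_succ_true (n : ℕ) : seqPoly (n + 1) (fun _ => True) =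
    (1 + X + 2 * X ^ 2 + X ^ 3) * seqPoly n (fun _ => True) -
      (X ^ 2 + X ^ 3) * seqPoly n (fun t => lowerBefore t 2 = 2) := by
  rw [seqPoly_succ, Fin.sum_univ_five, seqPoly_fits_of_eq_zero n (t := 0) rfl,
    seqPoly_fits_of_eq_zero n (t := 1) rfl, seqPoly_fits_of_eq_zero n (t := 2) rfl,
    seqPoly_fits_of_eq_one n (t := 3) rfl, seqPoly_fits_of_eq_one n (t := 4) rfl]
  simp [crossings, lowerBefore]
  ring

lemma seqPoly_succ_two (n : ℕ) : seqPoly (n + 1) (fun t => lowerBefore t 2 = 2) =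
    (X ^ 2 + X ^ 3) * seqPoly n (fun _ => True) -
      X ^ 3 * seqPoly n (fun t => lowerBefore t 2 = 2) := by
  rw [seqPoly_succ, Fin.sum_univ_five, seqPoly_fits_of_eq_zero n (t := 0) rfl,
    seqPoly_fits_of_eq_zero n (t := 1) rfl, seqPoly_fits_of_eq_zero n (t := 2) rfl,
    seqPoly_fits_of_eq_one n (t := 3) rfl, seqPoly_fits_of_eq_one n (t := 4) rfl]
  simp [crossings, lowerBefore]
  ring

lemma compatible_of_isEmpty (T : Fin 0 → Fin 5) : Compatible T := by
  rintro (_ | g) <;> simp [padded, Fits, lowerBefore]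

lemma seqPoly_true_eq_Fpoly (n : ℕ) : seqPoly n (fun _ => True) = Fpoly (n + 1) := by
  have h0 : seqPoly 0 (fun _ => True) = 1 := by
    simp [seqPoly, compatible_of_isEmpty]
  have h0' : seqPoly 0 (fun t => lowerBefore t 2 = 2) = 0 := by
    simp [seqPoly, padded, lowerBefore]
  induction n using Nat.twoStepInduction with
  | zero => rw [h0, Fpoly]
  | one => rw [seqPoly_succ_true, h0, h0', Fpoly, Fpoly, Fpoly]; ring
  | more n ih1 ih2 =>
    rw [Fpoly, ← ih1, ← ih2, seqPoly_succ_true (n + 1), seqPoly_succ_two, seqPoly_succ_true]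
    ring

end Transfer

open Classical in
lemma Fpoly_succ_sum (n : ℕ) (f : ℕ → ℕ) :
    ((Fpoly (n + 1)).sum fun k c => C c * (X : ℤ[X]) ^ f k) =
      ∑ T : Fin n → Fin 5 with Compatible T, X ^ f (∑ i, crossings (T i)) := by
  let L : ℤ[X] →ₗ[ℤ] ℤ[X] := Polynomial.lsum fun k => (monomial (f k) : ℤ →ₗ[ℤ] ℤ[X])
  have hL : ∀ p : ℤ[X], (p.sum fun k c => C c * (X : ℤ[X]) ^ f k) = L p := by
    intro p
    simp only [L, Polynomial.lsum_apply, C_mul_X_pow_eq_monomial]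
  have hX : ∀ k, L (X ^ k) = X ^ f k := by
    intro k
    rw [← hL, X_pow_eq_monomial, Polynomial.sum_monomial_index _ _ (by simp)]
    simp
  rw [hL, ← seqPoly_true_eq_Fpoly]
  simp only [seqPoly, and_true]
  rw [← Finset.sum_filter, map_sum]
  exact Finset.sum_congr rfl fun T _ => hX _

/-- **Theorem 4.** For all `s ≥ 1`, `N_{s,3}(2143)(q) = q^{9·C(s,2)} F_s(1/q)`; that is,
writing `F_s(r) = Σ_k c_k r^k`, we have `N_{s,3}(2143)(q) = Σ_k c_k q^{9·C(s,2) − k}`. -/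
theorem NPoly_s_three_2143 (s : ℕ) (hs : 1 ≤ s) :
    NPoly s 3 pat2143 =
      (Fpoly s).sum fun k c => Polynomial.C c * X ^ (9 * Nat.choose s 2 - k) := by
  obtain ⟨n, rfl⟩ := Nat.exists_eq_add_of_le' hs
  classical
  rw [Fpoly_succ_sum n (fun k => 9 * (n + 1).choose 2 - k), NPoly]
  symm
  refine Finset.sum_bij (fun T _ => wordOf T) ?_ ?_ ?_ ?_
  · intro T hT
    have hT := (Finset.mem_filter.1 hT).2
    exact Finset.mem_filter.2
      ⟨Finset.mem_univ _, isLinExtN_and_not_permContains_iff.2 (rowOrdered_wordOf hT)⟩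
  · intro T hT T' hT' he
    have h1 := linked_wordOf (Finset.mem_filter.1 hT).2
    have h2 := linked_wordOf (Finset.mem_filter.1 hT').2
    rw [he] at h1
    exact h1.unique h2
  · intro w hw
    obtain ⟨T, hT, rfl⟩ :=
      exists_wordOf_eq (isLinExtN_and_not_permContains_iff.1 (Finset.mem_filter.1 hw).2)
    exact ⟨T, Finset.mem_filter.2 ⟨Finset.mem_univ _, hT⟩, rfl⟩
  · intro T hT
    have hT := (Finset.mem_filter.1 hT).2
    have := invCount_add_sum_crossings (rowOrdered_wordOf hT) (linked_wordOf hT)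
    congr 1
    omega
end

section
/- For all integers s ≥ 2, H_s(q) = q^{9(s−1)−1}(1+q)·N_{s−1,3}(2143)(q) + q^{9(s−1)−2}·H_{s−1}(q) as polynomials in q. -/
open Polynomial

open Classical in
/-- `H_s(q) = Σ_{w ∈ H_s} q^{inv(w)}`, where `H_s` is the set of `w ∈ N_{s,3}(2143)` whose
second entry `w_2` is the 1-indexed label `3s−1` (0-indexed: position `1` carries `3s−2`). -/
noncomputable def HsPoly (s : ℕ) : Polynomial ℤ :=
  ∑ w ∈ Finset.univ.filter
      (fun w : Equiv.Perm (Fin (s * 3)) => IsLinExtN s 3 w ∧ ¬ PermContains w pat2143 ∧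
        ∀ p : Fin (s * 3), (p : ℕ) = 1 → (w p : ℕ) = 3 * s - 2),
    (X : Polynomial ℤ) ^ invCount w

open Equiv in
/-- Insert a new maximum at position `p`. -/
def insertMax {n : ℕ} (p : Fin (n + 1)) (v : Perm (Fin n)) : Perm (Fin (n + 1)) :=
  (finSuccEquiv' p).trans ((optionCongr v).trans (finSuccEquiv' (Fin.last n)).symm)

section insertMax

variable {n : ℕ} (p : Fin (n + 1)) (v : Equiv.Perm (Fin n))

@[simp] lemma insertMax_self : insertMax p v p = Fin.last n := by
  simp [insertMax]

@[simp] lemma insertMax_succAbove (i : Fin n) :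
    insertMax p v (p.succAbove i) = (v i).castSucc := by
  simp [insertMax]

@[simp] lemma insertMax_symm_last : (insertMax p v).symm (Fin.last n) = p := by
  simp [Equiv.symm_apply_eq]

lemma insertMax_injective : Function.Injective (insertMax p) := by
  intro v v' h
  ext i
  have := congrArg (fun w => w (p.succAbove i)) h
  simpa [Fin.ext_iff] using this

lemma exists_insertMax {w : Equiv.Perm (Fin (n + 1))} (h : w p = Fin.last n) :
    ∃ v, w = insertMax p v := by
  have hne : ∀ i, w (p.succAbove i) ≠ Fin.last n := fun i hi =>
    Fin.succAbove_ne p i (w.injective (hi.trans h.symm))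
  choose g hg using fun i => Fin.exists_castSucc_eq.2 (hne i)
  have hinj : Function.Injective g := fun i j hij => by
    apply Fin.succAbove_right_injective (p := p)
    apply w.injective
    rw [← hg, ← hg, hij]
  refine ⟨Equiv.ofBijective g (Finite.injective_iff_bijective.1 hinj), ?_⟩
  apply Equiv.ext
  intro x
  induction x using p.succAboveCases with
  | x => simp [h]
  | p i => simp [hg]

lemma invCount_eq_sum_s13 (v : Equiv.Perm (Fin n)) :
    invCount v = ∑ x, ∑ y, if x < y ∧ v y < v x then 1 else 0 := by
  rw [invCount, Finset.card_filter, Fintype.sum_prod_type]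

lemma invCount_insertMax : invCount (insertMax p v) = invCount v + (n - p) := by
  have hcount : (∑ j : Fin n, if p ≤ j.castSucc then 1 else 0) = n - (p : ℕ) := by
    simp only [Fin.le_def, Fin.val_castSucc]
    rw [Fin.sum_univ_eq_sum_range (fun j => if (p : ℕ) ≤ j then 1 else 0) n,
      ← Finset.card_filter, ← Nat.card_Ico]
    congr 1
    ext j
    simp [and_comm]
  rw [invCount_eq_sum_s13, invCount_eq_sum_s13, Fin.sum_univ_succAbove _ p,
    Fin.sum_univ_succAbove _ p]
  simp only [Fin.sum_univ_succAbove _ p, insertMax_self, insertMax_succAbove,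
    Fin.castSucc_lt_castSucc_iff, Fin.succAbove_lt_succAbove_iff, Fin.castSucc_lt_last,
    Fin.lt_succAbove_iff_le_castSucc, and_true, lt_self_iff_false, if_false,
    Fin.not_lt.2 (Fin.le_last _), and_false, zero_add, hcount]
  exact add_comm _ _

lemma permContains_pat2143_iff :
    PermContains v pat2143 ↔
      ∃ i j k l, i < j ∧ j < k ∧ k < l ∧ v j < v i ∧ v i < v l ∧ v l < v k := by
  constructor
  · rintro ⟨f, hf, h⟩
    exact ⟨f 0, f 1, f 2, f 3, hf (by decide), hf (by decide), hf (by decide),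
      (h _ _).2 (by decide), (h _ _).2 (by decide), (h _ _).2 (by decide)⟩
  · rintro ⟨i, j, k, l, hij, hjk, hkl, h1, h2, h3⟩
    refine ⟨![i, j, k, l], ?_, ?_⟩
    · rw [Fin.strictMono_iff_lt_succ]
      intro a
      fin_cases a <;> simpa
    · intro a b
      fin_cases a <;> fin_cases b <;> simp [pat2143] <;> order

lemma permContains_insertMax_iff :
    PermContains (insertMax p v) pat2143 ↔ PermContains v pat2143 ∨
      ∃ i j l, i < j ∧ j.castSucc < p ∧ p ≤ l.castSucc ∧ v j < v i ∧ v i < v l := by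
  simp only [permContains_pat2143_iff]
  constructor
  · rintro ⟨i, j, k, l, hij, hjk, hkl, h1, h2, h3⟩
    have hne : ∀ x y, insertMax p v x < insertMax p v y → ∃ x', p.succAbove x' = x := by
      intro x y hxy
      refine Fin.exists_succAbove_eq fun h => ?_
      rw [h, insertMax_self] at hxy
      exact absurd (Fin.le_last _) (not_le.2 hxy)
    obtain ⟨i, rfl⟩ := hne _ _ h2
    obtain ⟨j, rfl⟩ := hne _ _ h1
    obtain ⟨l, rfl⟩ := hne _ _ h3
    simp only [insertMax_succAbove, Fin.castSucc_lt_castSucc_iff,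
      Fin.succAbove_lt_succAbove_iff] at h1 h2 hij
    by_cases hk : k = p
    · subst hk
      exact .inr ⟨i, j, l, hij, Fin.succAbove_lt_iff_castSucc_lt _ _ |>.1 hjk,
        Fin.lt_succAbove_iff_le_castSucc _ _ |>.1 hkl, h1, h2⟩
    · obtain ⟨k, rfl⟩ := Fin.exists_succAbove_eq hk
      simp only [insertMax_succAbove, Fin.castSucc_lt_castSucc_iff,
        Fin.succAbove_lt_succAbove_iff] at h3 hjk hkl
      exact .inl ⟨i, j, k, l, hij, hjk, hkl, h1, h2, h3⟩
  · rintro (⟨i, j, k, l, h⟩ | ⟨i, j, l, hij, hj, hl, h1, h2⟩)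
    · exact ⟨p.succAbove i, p.succAbove j, p.succAbove k, p.succAbove l, by simpa using h⟩
    · exact ⟨p.succAbove i, p.succAbove j, p, p.succAbove l, by simpa using hij,
        Fin.succAbove_lt_iff_castSucc_lt _ _ |>.2 hj,
        Fin.lt_succAbove_iff_le_castSucc _ _ |>.2 hl, by simpa using h1, by simpa using h2,
        by simp⟩

end insertMax

/-- Insert three new maxima, in increasing order, at positions `0`, `1` and `p`. -/
def insertRow {m : ℕ} (p : Fin (m + 3)) (v : Equiv.Perm (Fin m)) : Equiv.Perm (Fin (m + 3)) :=
  insertMax p (insertMax 1 (insertMax 0 v))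

section insertRow

variable {m : ℕ} {p : Fin (m + 3)} (v : Equiv.Perm (Fin m))

lemma insertRow_injective : Function.Injective (insertRow p) :=
  (insertMax_injective p).comp ((insertMax_injective 1).comp (insertMax_injective 0))

lemma invCount_insertRow :
    invCount (insertRow p v) + p = invCount v + 3 * m + 2 := by
  have := p.isLt
  simp only [insertRow, invCount_insertMax, Fin.val_zero, Fin.val_one]
  omega

lemma insertMax_one_insertMax_zero_succ_succ (i : Fin m) :
    insertMax 1 (insertMax 0 v) i.succ.succ = (v i).castSucc.castSucc := by
  have h1 : (i.succ.succ : Fin (m + 2)) = (1 : Fin (m + 2)).succAbove i.succ := by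
    rw [Fin.succAbove_of_le_castSucc]
    simp [Fin.le_def]
  have h0 : (i.succ : Fin (m + 1)) = (0 : Fin (m + 1)).succAbove i := by simp
  rw [h1, insertMax_succAbove, h0, insertMax_succAbove]

lemma insertMax_one_insertMax_zero_zero :
    insertMax 1 (insertMax 0 v) 0 = (Fin.last m).castSucc := by
  have h1 : (0 : Fin (m + 2)) = (1 : Fin (m + 2)).succAbove 0 := by simp
  rw [h1, insertMax_succAbove, insertMax_self]

lemma insertMax_one_insertMax_zero_one :
    insertMax 1 (insertMax 0 v) 1 = Fin.last (m + 1) :=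
  insertMax_self _ _

lemma permContains_insertRow_iff :
    PermContains (insertRow p v) pat2143 ↔ PermContains v pat2143 ∨
      ∃ i j l : Fin m, i < j ∧ (j : ℕ) + 2 < p ∧ (p : ℕ) ≤ l + 2 ∧ v j < v i ∧ v i < v l := by
  have h0 : ∀ {k : ℕ} (u : Equiv.Perm (Fin (k + 1))),
      ¬ ∃ i j l : Fin (k + 1), i < j ∧ j.castSucc < (1 : Fin (k + 2)) ∧
        (1 : Fin (k + 2)) ≤ l.castSucc ∧ u j < u i ∧ u i < u l := by
    rintro k u ⟨i, j, l, hij, hj, -⟩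
    simp only [Fin.lt_def, Fin.val_castSucc, Fin.val_one] at hij hj
    omega
  rw [insertRow, permContains_insertMax_iff, permContains_insertMax_iff,
    permContains_insertMax_iff, or_iff_left (h0 _), or_assoc]
  refine or_congr_right ⟨?_, ?_⟩
  · rintro (⟨i, j, l, -, hj, -⟩ | ⟨i, j, l, hij, hj, hl, h1, h2⟩)
    · exact absurd hj (Fin.not_lt_zero _)
    · induction i using Fin.cases with
      | zero =>
        rw [insertMax_one_insertMax_zero_zero] at h1 h2
        have hl1 : insertMax 1 (insertMax 0 v) l = Fin.last (m + 1) := by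
          simp only [Fin.lt_def, Fin.ext_iff, Fin.val_castSucc, Fin.val_last] at h2 ⊢
          omega
        have : l = 1 := (insertMax 1 (insertMax 0 v)).injective
          (hl1.trans (insertMax_one_insertMax_zero_one v).symm)
        simp only [this, Fin.lt_def, Fin.le_def, Fin.val_castSucc, Fin.val_one,
          Fin.val_zero] at hij hj hl
        omega
      | succ i =>
        induction i using Fin.cases with
        | zero =>
          rw [Fin.succ_zero_eq_one, insertMax_one_insertMax_zero_one] at h2
          exact absurd (Fin.le_last _) (not_le.2 h2)
        | succ i =>
          have hl' := lt_of_lt_of_le hj hl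
          simp only [Fin.lt_def, Fin.le_def, Fin.val_castSucc, Fin.val_succ] at hij hj hl hl'
          obtain ⟨j, rfl⟩ : ∃ j' : Fin m, j = j'.succ.succ :=
            ⟨⟨j - 2, by omega⟩, by ext; simp; omega⟩
          obtain ⟨l, rfl⟩ : ∃ l' : Fin m, l = l'.succ.succ :=
            ⟨⟨l - 2, by omega⟩, by ext; simp; omega⟩
          simp only [insertMax_one_insertMax_zero_succ_succ,
            Fin.castSucc_lt_castSucc_iff] at h1 h2
          simp only [Fin.val_succ] at hij hj hl
          exact ⟨i, j, l, by omega, by omega, by omega, h1, h2⟩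
  · rintro ⟨i, j, l, hij, hj, hl, h1, h2⟩
    refine .inr ⟨i.succ.succ, j.succ.succ, l.succ.succ, by simpa, ?_, ?_, ?_⟩
    · simp only [Fin.lt_def, Fin.val_castSucc, Fin.val_succ]; omega
    · simp only [Fin.le_def, Fin.val_castSucc, Fin.val_succ]; omega
    · simpa [insertMax_one_insertMax_zero_succ_succ] using ⟨h1, h2⟩

lemma insertRow_succAbove (i : Fin (m + 2)) :
    insertRow p v (p.succAbove i) = (insertMax 1 (insertMax 0 v) i).castSucc :=
  insertMax_succAbove _ _ _

lemma insertRow_symm_val (hp : 2 ≤ (p : ℕ)) (x : Fin (m + 3)) :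
    ((insertRow p v).symm x : ℕ) = if h : (x : ℕ) < m then
      (if (v.symm ⟨x, h⟩ : ℕ) + 2 < p then (v.symm ⟨x, h⟩ : ℕ) + 2 else (v.symm ⟨x, h⟩ : ℕ) + 3)
      else if (x : ℕ) = m then 0 else if (x : ℕ) = m + 1 then 1 else p := by
  have key : ∀ y, insertRow p v y = x → (insertRow p v).symm x = y := fun y hy => by
    rw [← hy, Equiv.symm_apply_apply]
  split_ifs with h h' h' h'
  · rw [key (p.succAbove (v.symm ⟨x, h⟩).succ.succ)
      (by rw [insertRow_succAbove, insertMax_one_insertMax_zero_succ_succ]; ext; simp)]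
    rw [Fin.succAbove_of_castSucc_lt _ _ (by simpa [Fin.lt_def] using h')]
    simp
  · rw [key (p.succAbove (v.symm ⟨x, h⟩).succ.succ)
      (by rw [insertRow_succAbove, insertMax_one_insertMax_zero_succ_succ]; ext; simp)]
    rw [Fin.succAbove_of_le_castSucc _ _ (by simpa [Fin.le_def] using h')]
    simp
  · rw [key (p.succAbove 0)
      (by rw [insertRow_succAbove, insertMax_one_insertMax_zero_zero]; ext; simp [h'])]
    rw [Fin.succAbove_of_castSucc_lt _ _
      (by rw [Fin.lt_def, Fin.val_castSucc, Fin.val_zero]; omega)]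
    simp
  · rw [key (p.succAbove 1)
      (by rw [insertRow_succAbove, insertMax_one_insertMax_zero_one]; ext; simp [h'])]
    rw [Fin.succAbove_of_castSucc_lt _ _
      (by rw [Fin.lt_def, Fin.val_castSucc, Fin.val_one]; omega)]
    simp
  · rw [key p (by rw [insertRow, insertMax_self]; ext; simp; omega)]

lemma exists_insertRow {w : Equiv.Perm (Fin (m + 3))} (h0 : (w 0 : ℕ) = m)
    (h1 : (w 1 : ℕ) = m + 1) : ∃ (p : Fin (m + 3)) (v : Equiv.Perm (Fin m)),
      2 ≤ (p : ℕ) ∧ w = insertRow p v := by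
  obtain ⟨p, hp⟩ : ∃ p, w p = Fin.last (m + 2) := w.surjective _
  have hp2 : 2 ≤ (p : ℕ) := by
    by_contra! h
    have : p = 0 ∨ p = 1 := by
      simp only [Fin.ext_iff, Fin.val_zero, Fin.val_one]; omega
    rcases this with rfl | rfl <;> simp [hp] at h0 h1
  obtain ⟨u, rfl⟩ := exists_insertMax p hp
  have e0 : p.succAbove 0 = 0 := by
    rw [Fin.succAbove_of_castSucc_lt _ _
      (by rw [Fin.lt_def, Fin.val_castSucc, Fin.val_zero]; omega)]
    simp
  have e1 : p.succAbove 1 = 1 := by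
    rw [Fin.succAbove_of_castSucc_lt _ _
      (by rw [Fin.lt_def, Fin.val_castSucc, Fin.val_one]; omega)]
    simp
  rw [← e0, insertMax_succAbove, Fin.val_castSucc] at h0
  rw [← e1, insertMax_succAbove, Fin.val_castSucc] at h1
  obtain ⟨u, rfl⟩ := exists_insertMax (n := m + 1) 1 (w := u) (by ext; simp [h1])
  rw [show (0 : Fin (m + 2)) = (1 : Fin (m + 2)).succAbove 0 by simp, insertMax_succAbove,
    Fin.val_castSucc] at h0
  obtain ⟨v, rfl⟩ := exists_insertMax (n := m) 0 (w := u) (by ext; simp [h0])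
  exact ⟨p, v, hp2, rfl⟩

end insertRow

/-- The linear extension condition of `IsLinExtN _ 3`, for words of arbitrary length. -/
def IsLinExtThree {n : ℕ} (w : Equiv.Perm (Fin n)) : Prop :=
  (∀ a b : Fin n, (b : ℕ) = (a : ℕ) + 1 → ¬ (3 ∣ ((a : ℕ) + 1)) → w.symm a < w.symm b) ∧
  (∀ a b : Fin n, (b : ℕ) + 3 = (a : ℕ) → w.symm a < w.symm b)

section IsLinExtThree

variable {m : ℕ} {v : Equiv.Perm (Fin m)}

lemma IsLinExtThree.apply_zero (hv : IsLinExtThree v) (h3 : 3 ∣ m) {x : Fin m}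
    (hx : (x : ℕ) = 0) : (v x : ℕ) = m - 3 := by
  by_contra hne
  have hlt := (v x).isLt
  have key : ∀ a : Fin m, ¬ v.symm a < v.symm (v x) := fun a ha => by
    rw [Equiv.symm_apply_apply, Fin.lt_def] at ha
    omega
  by_cases hd : 3 ∣ (v x : ℕ)
  · exact key ⟨v x + 3, by omega⟩ (hv.2 _ _ rfl)
  · exact key ⟨v x - 1, by omega⟩ (hv.1 _ _ (by simp only; omega) (by simp only; omega))

lemma IsLinExtThree.two_le_symm (hv : IsLinExtThree v) (h3 : 3 ∣ m) {c : Fin m}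
    (hc : (c : ℕ) + 1 = m) : 2 ≤ (v.symm c : ℕ) := by
  have h1 := hv.1 ⟨m - 3, by omega⟩ ⟨m - 2, by omega⟩ (by simp only; omega)
    (by simp only; omega)
  have h2 := hv.1 ⟨m - 2, by omega⟩ c (by simp only; omega) (by simp only; omega)
  rw [Fin.lt_def] at h1 h2
  omega

lemma isLinExtThree_insertRow_iff (h3 : 3 ∣ m) {p : Fin (m + 3)} (hp : 2 ≤ (p : ℕ)) :
    IsLinExtThree (insertRow p v) ↔
      IsLinExtThree v ∧ ∀ c : Fin m, (c : ℕ) + 1 = m → (p : ℕ) ≤ v.symm c + 2 := by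
  simp only [IsLinExtThree, Fin.lt_def, insertRow_symm_val v hp]
  constructor
  · rintro ⟨h1, h2⟩
    refine ⟨⟨fun a b hab ha => ?_, fun a b hab => ?_⟩, fun c hc => ?_⟩
    · have := h1 (a.castAdd 3) (b.castAdd 3) hab ha
      simp only [Fin.val_castAdd, Fin.is_lt, dite_true, Fin.eta] at this
      split_ifs at this <;> omega
    · have := h2 (a.castAdd 3) (b.castAdd 3) hab
      simp only [Fin.val_castAdd, Fin.is_lt, dite_true, Fin.eta] at this
      split_ifs at this <;> omega
    · have := h2 (Fin.last _) (c.castAdd 3) (by simp; omega)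
      simp only [Fin.val_castAdd, Fin.is_lt, dite_true, Fin.eta, Fin.val_last] at this
      split_ifs at this <;> omega
  · rintro ⟨⟨h1, h2⟩, hc⟩
    refine ⟨fun a b hab ha => ?_, fun a b hab => ?_⟩
    · by_cases hb : (b : ℕ) < m
      · have ham : (a : ℕ) < m := by omega
        have := h1 ⟨a, ham⟩ ⟨b, hb⟩ hab ha
        simp only [hb, ham, dite_true]
        split_ifs <;> omega
      · have ham : ¬ (a : ℕ) < m := by omega
        simp only [hb, ham, dite_false]
        split_ifs <;> omega
    · have hb : (b : ℕ) < m := by omega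
      by_cases ham : (a : ℕ) < m
      · have := h2 ⟨a, ham⟩ ⟨b, hb⟩ hab
        simp only [hb, ham, dite_true]
        split_ifs <;> omega
      · have := hc ⟨b, hb⟩
        simp only at this
        simp only [hb, ham, dite_true, dite_false]
        split_ifs <;> omega

/-- `IsGood v` says that `v` is a `2143`-avoiding linear extension. -/
def IsGood (v : Equiv.Perm (Fin m)) : Prop :=
  IsLinExtThree v ∧ ¬ PermContains v pat2143

/-- The second letter of `v` is its second largest letter. -/
def IsSecondLarge (v : Equiv.Perm (Fin m)) : Prop :=
  ∀ x : Fin m, (x : ℕ) = 1 → (v x : ℕ) = m - 2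

lemma isGood_insertRow_iff (hm : 0 < m) (h3 : 3 ∣ m) {p : Fin (m + 3)} (hp : 2 ≤ (p : ℕ)) :
    IsGood (insertRow p v) ↔
      IsGood v ∧ (p : ℕ) ≤ 4 ∧ ((p : ℕ) = 4 → IsSecondLarge v) := by
  rw [IsGood, IsGood, isLinExtThree_insertRow_iff h3 hp, permContains_insertRow_iff]
  constructor
  · rintro ⟨⟨hv, hc⟩, hav⟩
    rw [not_or] at hav
    have h0 := hv.apply_zero h3 (x := ⟨0, hm⟩) rfl
    have hcp := hc ⟨m - 1, by omega⟩ (by simp only; omega)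
    have key : ∀ j : Fin m, 0 < (j : ℕ) → (j : ℕ) + 2 < p → (v j : ℕ) = m - 2 := by
      intro j hj0 hjp
      have hne : (v j : ℕ) ≠ m - 3 := fun h => by
        have : j = ⟨0, hm⟩ := v.injective (Fin.ext (h.trans h0.symm))
        simp [this] at hj0
      have hne' : (v j : ℕ) ≠ m - 1 := fun h => by
        have : j = v.symm ⟨m - 1, by omega⟩ := (Equiv.symm_apply_eq v).2 (Fin.ext h.symm) |>.symm
        omega
      have hge : ¬ (v j : ℕ) < m - 3 := fun h =>
        hav.2 ⟨⟨0, hm⟩, j, v.symm ⟨m - 1, by omega⟩, hj0, hjp, hcp,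
          by rw [Fin.lt_def]; omega, by rw [Fin.lt_def, Equiv.apply_symm_apply]; simp only; omega⟩
      omega
    refine ⟨⟨hv, hav.1⟩, ?_, fun h4 x hx => key x (by omega) (by omega)⟩
    by_contra! h5
    have h1 := key ⟨1, by omega⟩ (by simp) (by simp only; omega)
    have h2 := key ⟨2, by omega⟩ (by simp) (by simp only; omega)
    simpa using v.injective (Fin.ext (h1.trans h2.symm))
  · rintro ⟨⟨hv, hav⟩, h4, hs⟩
    refine ⟨⟨hv, fun c hc => ?_⟩, ?_⟩
    · have := hv.two_le_symm h3 hc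
      omega
    · rintro (h | ⟨i, j, l, hij, hj, -, hlt, -⟩)
      · exact hav h
      · rw [Fin.lt_def] at hij hlt
        have h0 := hv.apply_zero h3 (x := i) (by omega)
        have h1 := hs (by omega) j (by omega)
        omega

lemma isSecondLarge_insertRow {p : Fin (m + 3)} (hp : 2 ≤ (p : ℕ)) :
    IsSecondLarge (insertRow p v) := by
  intro x hx
  have h := insertRow_symm_val v hp ⟨m + 1, by omega⟩
  simp only [show ¬ m + 1 < m by omega, show m + 1 ≠ m by omega, dite_false, if_false,
    if_true] at h
  have : (insertRow p v).symm ⟨m + 1, by omega⟩ = x := Fin.ext (h.trans hx.symm)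
  rw [← this, Equiv.apply_symm_apply]
  simp

open Classical in
lemma sum_isGood_isSecondLarge {n : ℕ} (hn : n = m + 3) (hm : 0 < m) (h3 : 3 ∣ m) :
    (∑ w ∈ Finset.univ.filter (fun w : Equiv.Perm (Fin n) => IsGood w ∧ IsSecondLarge w),
      (X : Polynomial ℤ) ^ invCount w) =
    X ^ (3 * m - 1) * (1 + X) *
      (∑ v ∈ Finset.univ.filter (fun v : Equiv.Perm (Fin m) => IsGood v), X ^ invCount v) +
    X ^ (3 * m - 2) *
      ∑ v ∈ Finset.univ.filter (fun v : Equiv.Perm (Fin m) => IsGood v ∧ IsSecondLarge v),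
        X ^ invCount v := by
  subst hn
  let pos : Fin 3 → Fin (m + 3) := fun k => ⟨k + 2, by omega⟩
  have hpos : ∀ k, 2 ≤ (pos k : ℕ) := fun k => Nat.le_add_left _ _
  have hset : Finset.univ.filter
        (fun w : Equiv.Perm (Fin (m + 3)) => IsGood w ∧ IsSecondLarge w) =
      (Finset.univ.filter fun x : Fin 3 × Equiv.Perm (Fin m) =>
        IsGood x.2 ∧ (x.1 = 2 → IsSecondLarge x.2)).image
          fun x => insertRow (pos x.1) x.2 := by
    ext w
    simp only [Finset.mem_filter, Finset.mem_univ, true_and, Finset.mem_image, Prod.exists]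
    constructor
    · rintro ⟨hg, hs⟩
      obtain ⟨p, v, hp, rfl⟩ := exists_insertRow
        (hg.1.apply_zero (Dvd.dvd.add h3 (dvd_refl 3)) (x := 0) rfl) (hs 1 (by simp))
      obtain ⟨hv, h4, hs'⟩ := (isGood_insertRow_iff hm h3 hp).1 hg
      refine ⟨⟨p - 2, by omega⟩, v, ⟨hv, fun h => hs' ?_⟩, ?_⟩
      · simp [Fin.ext_iff] at h
        omega
      · congr
        ext
        simp [pos]
        omega
    · rintro ⟨k, v, ⟨hv, hs⟩, rfl⟩
      refine ⟨(isGood_insertRow_iff hm h3 (hpos k)).2 ⟨hv, ?_, fun h => hs ?_⟩,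
        isSecondLarge_insertRow (hpos k)⟩
      · simp only [pos]; omega
      · simp only [pos] at h; ext; simp; omega
  have hinj : Function.Injective
      fun x : Fin 3 × Equiv.Perm (Fin m) => insertRow (pos x.1) x.2 := by
    rintro ⟨k, v⟩ ⟨k', v'⟩ h
    have hk := congrArg (fun w => w.symm (Fin.last _)) h
    simp only [insertRow, insertMax_symm_last, pos, Fin.mk.injEq, Nat.add_right_cancel_iff,
      Fin.val_inj] at hk
    subst hk
    exact congrArg _ (insertRow_injective h)
  have hinv : ∀ (k : Fin 3) (v : Equiv.Perm (Fin m)),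
      invCount (insertRow (pos k) v) = (3 * m - k) + invCount v := fun k v => by
    have := invCount_insertRow (p := pos k) v
    simp only [pos] at this ⊢
    omega
  have h1 : 3 * m = (3 * m - 1) + 1 := by omega
  rw [hset, Finset.sum_image hinj.injOn, Finset.sum_filter, Fintype.sum_prod_type,
    Fin.sum_univ_three]
  simp only [hinv, Finset.sum_filter, Finset.mul_sum, Fin.val_zero, Fin.val_one, Fin.val_two,
    Nat.sub_zero, ← Finset.sum_add_distrib]
  refine Finset.sum_congr rfl fun v _ => ?_
  have : X ^ (3 * m) = (X : Polynomial ℤ) ^ (3 * m - 1) * X := by rw [← pow_succ, ← h1]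
  by_cases hg : IsGood v <;> by_cases hs : IsSecondLarge v <;> simp [hg, hs, pow_add, this] <;>
    ring

end IsLinExtThree

open Classical in
lemma NPoly_three_eq (s : ℕ) :
    NPoly s 3 pat2143 =
      ∑ v ∈ Finset.univ.filter (fun v : Equiv.Perm (Fin (s * 3)) => IsGood v),
        X ^ invCount v := by
  unfold NPoly
  congr!

open Classical in
lemma HsPoly_eq (s : ℕ) :
    HsPoly s =
      ∑ v ∈ Finset.univ.filter
          (fun v : Equiv.Perm (Fin (s * 3)) => IsGood v ∧ IsSecondLarge v),
        X ^ invCount v := by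
  simp only [IsGood, IsSecondLarge, mul_comm s 3, and_assoc]
  rfl

/-- **Equation (3).** For `s ≥ 2`,
`H_s(q) = q^{9(s−1)−1}(1+q) N_{s−1,3}(2143)(q) + q^{9(s−1)−2} H_{s−1}(q)`. -/
theorem HsPoly_recurrence (s : ℕ) (hs : 2 ≤ s) :
    HsPoly s =
      X ^ (9 * (s - 1) - 1) * (1 + X) * NPoly (s - 1) 3 pat2143 +
        X ^ (9 * (s - 1) - 2) * HsPoly (s - 1) := by
  obtain ⟨r, rfl⟩ : ∃ r, s = r + 1 := ⟨s - 1, by omega⟩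
  rw [Nat.add_sub_cancel, show 9 * r = 3 * (r * 3) by ring, HsPoly_eq, HsPoly_eq,
    NPoly_three_eq]
  exact sum_isGood_isSecondLarge (Nat.succ_mul r 3) (by omega) (Nat.dvd_mul_left 3 r)
end

section
/- For all integers s ≥ 2, the coefficient of r^{s+1} in F_s(r) equals the binomial coefficient C(2s−1, s−2). -/
open Polynomial

/-- The generating function `∑ C(2m + j, m) z ^ m`. -/
def chooseSeries (j : ℕ) : PowerSeries ℤ :=
  PowerSeries.mk fun m => (Nat.choose (2 * m + j) m : ℤ)

lemma chooseSeries_succ (j : ℕ) :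
    chooseSeries (j + 1) = chooseSeries j + PowerSeries.X * chooseSeries (j + 2) := by
  ext m
  cases m with
  | zero => simp [chooseSeries]
  | succ m =>
    rw [map_add, PowerSeries.coeff_succ_X_mul]
    simp only [chooseSeries, PowerSeries.coeff_mk]
    rw [show 2 * (m + 1) + (j + 1) = (2 * m + (j + 2)) + 1 by ring,
      show 2 * (m + 1) + j = 2 * m + (j + 2) by ring, Nat.choose_succ_succ]
    push_cast
    ring

lemma chooseSeries_zero : chooseSeries 0 = 1 + 2 * PowerSeries.X * chooseSeries 1 := by
  ext m
  rw [mul_comm 2, mul_assoc]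
  cases m with
  | zero => simp [chooseSeries]
  | succ m =>
    rw [map_add, PowerSeries.coeff_succ_X_mul, two_mul, map_add]
    simp only [chooseSeries, PowerSeries.coeff_mk, PowerSeries.coeff_one]
    rw [show 2 * (m + 1) + 0 = (2 * m + 1) + 1 by ring, Nat.choose_succ_succ,
      Nat.choose_symm_half]
    push_cast
    ring

lemma chooseSeries_succ_eq_mul {c : PowerSeries ℤ} (hc : c = 1 + PowerSeries.X * c ^ 2) (j : ℕ) :
    chooseSeries (j + 1) = c * chooseSeries j := by
  have step (i : ℕ) : chooseSeries (i + 1) - c * chooseSeries i =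
      PowerSeries.X * (c * (chooseSeries (i + 2) - c * chooseSeries (i + 1))) := by
    linear_combination c * chooseSeries_succ i - chooseSeries (i + 1) * hc
  have dvd (n : ℕ) : ∀ i, (PowerSeries.X : PowerSeries ℤ) ^ n ∣
      chooseSeries (i + 1) - c * chooseSeries i := by
    induction n with
    | zero => simp
    | succ n ih =>
      intro i
      rw [step, pow_succ']
      exact mul_dvd_mul_left _ ((ih (i + 1)).mul_left c)
  rw [← sub_eq_zero]
  ext m
  exact PowerSeries.X_pow_dvd_iff.1 (dvd (m + 1) j) m m.lt_succ_self

/-- A bilateral sequence that is geometric in both directions, with ratios `u` and `v`. -/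
def bilateralGeom {R : Type*} [Monoid R] (d u v : R) : ℤ → R
  | Int.ofNat n => d * u ^ n
  | Int.negSucc n => d * v ^ (n + 1)

lemma bilateralGeom_recurrence {R : Type*} [CommRing R] {z d u v : R}
    (hu : u = z * u ^ 2 + z * u + (2 * z + z ^ 2))
    (hv : v = z + z * v + (2 * z + z ^ 2) * v ^ 2)
    (hd : d * (1 - z * u - z - (2 * z + z ^ 2) * v) = 1) (k : ℤ) :
    bilateralGeom d u v k = z * bilateralGeom d u v (k + 1) + z * bilateralGeom d u v k
      + (2 * z + z ^ 2) * bilateralGeom d u v (k - 1) + if k = 0 then 1 else 0 := by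
  match k with
  | Int.ofNat 0 =>
    change d * u ^ 0 = z * (d * u ^ 1) + z * (d * u ^ 0) + (2 * z + z ^ 2) * (d * v ^ 1) + _
    simp only [Int.ofNat_eq_natCast, Nat.cast_zero, if_true]
    linear_combination hd
  | Int.ofNat (n + 1) =>
    rw [if_neg (by simp; omega), show Int.ofNat (n + 1) - 1 = Int.ofNat n by simp]
    change d * u ^ (n + 1) = z * (d * u ^ (n + 2)) + z * (d * u ^ (n + 1))
      + (2 * z + z ^ 2) * (d * u ^ n) + _
    linear_combination d * u ^ n * hu
  | Int.negSucc 0 =>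
    rw [if_neg (by simp)]
    change d * v ^ 1 = z * (d * u ^ 0) + z * (d * v ^ 1) + (2 * z + z ^ 2) * (d * v ^ 2) + _
    linear_combination d * hv
  | Int.negSucc (n + 1) =>
    rw [if_neg (by simp), show Int.negSucc (n + 1) + 1 = Int.negSucc n by omega,
      show Int.negSucc (n + 1) - 1 = Int.negSucc (n + 2) by omega]
    change d * v ^ (n + 2) = z * (d * v ^ (n + 1)) + z * (d * v ^ (n + 2))
      + (2 * z + z ^ 2) * (d * v ^ (n + 3)) + _
    linear_combination d * v ^ (n + 1) * hv

/-- The coefficient of a polynomial at an integer index, zero at negative indices. -/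
noncomputable def intCoeff (p : Polynomial ℤ) (n : ℤ) : ℤ :=
  if n < 0 then 0 else p.coeff n.toNat

lemma intCoeff_add (p q : Polynomial ℤ) (n : ℤ) :
    intCoeff (p + q) n = intCoeff p n + intCoeff q n := by
  unfold intCoeff
  split_ifs <;> simp

lemma intCoeff_one (n : ℤ) : intCoeff 1 n = if n = 0 then 1 else 0 := by
  unfold intCoeff
  rw [coeff_one]
  split_ifs <;> omega

lemma intCoeff_X_mul (p : Polynomial ℤ) (n : ℤ) :
    intCoeff (X * p) n = intCoeff p (n - 1) := by
  unfold intCoeff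
  rcases lt_trichotomy n 0 with h | rfl | h
  · rw [if_pos h, if_pos (by omega)]
  · simp
  · rw [if_neg (by omega), if_neg (by omega), show n.toNat = (n - 1).toNat + 1 by omega,
      coeff_X_mul]

lemma intCoeff_Fpoly_add_two (s : ℕ) (n : ℤ) :
    intCoeff (Fpoly (s + 2)) n = intCoeff (Fpoly (s + 1)) n + intCoeff (Fpoly (s + 1)) (n - 1)
      + 2 * intCoeff (Fpoly (s + 1)) (n - 2) + intCoeff (Fpoly s) (n - 3) := by
  have h : Fpoly (s + 2) = Fpoly (s + 1) + X * Fpoly (s + 1) + (X * (X * Fpoly (s + 1))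
      + X * (X * Fpoly (s + 1))) + X * (X * (X * Fpoly s)) := by
    rw [Fpoly]
    ring
  rw [h]
  simp only [intCoeff_add, intCoeff_X_mul, sub_sub, Int.reduceAdd]
  ring

lemma coeff_eq_intCoeff_Fpoly {A : ℤ → PowerSeries ℤ}
    (hA : ∀ k, A k = PowerSeries.X * (A (k + 1) + A k + 2 * A (k - 1)
      + PowerSeries.X * A (k - 1) - (if k = 0 then 1 else 0) - 2 * (if k = 1 then 1 else 0))
      + if k = 0 then 1 else 0) (s : ℕ) (k : ℤ) :
    PowerSeries.coeff s (A k) = intCoeff (Fpoly s) (s + k) := by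
  have coeff_ite (n : ℕ) (p : Prop) [Decidable p] :
      PowerSeries.coeff n (if p then 1 else 0 : PowerSeries ℤ) =
        if p then (if n = 0 then 1 else 0) else 0 := by
    split_ifs <;> simp [PowerSeries.coeff_one, *]
  have coeff_two_mul (n : ℕ) (f : PowerSeries ℤ) :
      PowerSeries.coeff n (2 * f) = 2 * PowerSeries.coeff n f := by
    rw [two_mul, map_add, two_mul]
  have h0 (k : ℤ) : PowerSeries.coeff 0 (A k) = if k = 0 then 1 else 0 := by
    rw [hA, map_add, PowerSeries.coeff_zero_X_mul, coeff_ite]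
    simp
  induction s using Nat.twoStepInduction generalizing k with
  | zero => rw [h0, Fpoly, intCoeff_one]; simp
  | one =>
    rw [hA, map_add, PowerSeries.coeff_succ_X_mul]
    simp only [map_add, map_sub, coeff_two_mul, coeff_ite, PowerSeries.coeff_zero_X_mul, h0]
    rw [Fpoly, intCoeff_one]
    push_cast
    split_ifs <;> omega
  | more s ih0 ih1 =>
    rw [hA, map_add, PowerSeries.coeff_succ_X_mul]
    simp only [map_add, map_sub, coeff_two_mul, coeff_ite, PowerSeries.coeff_succ_X_mul, ih0, ih1]
    rw [intCoeff_Fpoly_add_two]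
    push_cast
    simp
    ring_nf

lemma coeff_Fpoly_eq_coeff_chooseSeries (s : ℕ) :
    (Fpoly s).coeff (s + 1) =
      PowerSeries.coeff s (PowerSeries.X ^ 2 * chooseSeries 3 : PowerSeries ℤ) := by
  obtain ⟨c, hc, hc0⟩ : ∃ c : PowerSeries ℤ, c = 1 + PowerSeries.X * c ^ 2 ∧
      PowerSeries.constantCoeff c = 1 := by
    refine ⟨PowerSeries.catalanSeries.map (Nat.castRingHom ℤ), ?_, ?_⟩
    · conv_lhs => rw [← PowerSeries.catalanSeries_sq_mul_X_add_one]
      simp only [map_add, map_mul, map_pow, PowerSeries.map_X, map_one]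
      ring
    · rw [← PowerSeries.coeff_zero_eq_constantCoeff_apply, PowerSeries.coeff_map]
      simp
  obtain ⟨w, hw⟩ : ∃ w, (2 * c - 1) * w = 1 :=
    ⟨_, PowerSeries.mul_invOfUnit _ 1 (by rw [two_mul]; simp [hc0])⟩
  obtain ⟨i, hi⟩ : ∃ i : PowerSeries ℤ, (1 + PowerSeries.X) * i = 1 :=
    ⟨_, PowerSeries.mul_invOfUnit _ 1 (by simp)⟩
  have hE0 : chooseSeries 0 * (1 - 2 * PowerSeries.X * c) = 1 := by
    linear_combination chooseSeries_zero
      + 2 * PowerSeries.X * chooseSeries_succ_eq_mul hc 0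
  have hE3 : chooseSeries 3 = c ^ 3 * chooseSeries 0 := by
    rw [chooseSeries_succ_eq_mul hc, chooseSeries_succ_eq_mul hc, chooseSeries_succ_eq_mul hc]
    ring
  rw [hE3]
  generalize chooseSeries 0 = e at hE0
  set z : PowerSeries ℤ := PowerSeries.X
  obtain ⟨u, hu⟩ : ∃ u, u = (1 + z) * c - 1 := ⟨_, rfl⟩
  obtain ⟨v, hv⟩ : ∃ v, v = z * c ^ 3 * w := ⟨_, rfl⟩
  have huv : (2 + z) * v = u := by
    linear_combination z * c * (c + 1) * hw - (z * c * w + 1) * hc - hu + (2 + z) * hv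
  have hu_quad : u = z * u ^ 2 + z * u + (2 * z + z ^ 2) := by
    linear_combination (1 + z) ^ 2 * hc + (1 - z - z * (u + (1 + z) * c - 1)) * hu
  have hv_quad : v = z + z * v + (2 * z + z ^ 2) * v ^ 2 := by
    linear_combination z * w * (c ^ 2 + c - 1 + z * c ^ 2) * hc + z * hw - z * v * huv
      + (1 - z - z * u) * hv - z ^ 2 * c ^ 3 * w * hu
  have hd : e * i * (1 - z * u - z - (2 * z + z ^ 2) * v) = 1 := by
    linear_combination i * (1 + z) * hE0 + hi - e * i * z * huv - 2 * z * e * i * hu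
  have hB := bilateralGeom_recurrence hu_quad hv_quad hd
  set B := bilateralGeom (e * i) u v
  have hA := coeff_eq_intCoeff_Fpoly (A := fun k => (1 - z) * B k - 2 * z * B (k - 1))
    (fun k => by
      have h := hB (k - 1)
      simp only [sub_add_cancel, sub_eq_zero] at h
      simp only [add_sub_cancel_right]
      linear_combination (1 - z) * hB k - 2 * z * h) s 1
  have hB0 : B 0 = e * i := by
    change e * i * u ^ 0 = _
    ring
  have hB1 : B 1 = e * i * u := by
    change e * i * u ^ 1 = _
    ring
  have hA1 : (1 - z) * B 1 - 2 * z * B (1 - 1) = z ^ 2 * (c ^ 3 * e) := by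
    rw [sub_self, hB0, hB1]
    linear_combination e * i * (1 - z) * hu + e * i * (1 + z) * (1 + z * c) * hc
      + z ^ 2 * c ^ 3 * e * hi
  have hcoeff : intCoeff (Fpoly s) (s + 1) = (Fpoly s).coeff (s + 1) := by
    rw [intCoeff, if_neg (by omega)]
    congr 1
  rw [← hcoeff, ← hA, hA1]

/-- For all `s ≥ 2`, the coefficient of `r^{s+1}` in `F_s(r)` equals `C(2s−1, s−2)`. -/
theorem Fpoly_coeff_succ (s : ℕ) (hs : 2 ≤ s) :
    (Fpoly s).coeff (s + 1) = (Nat.choose (2 * s - 1) (s - 2) : ℤ) := by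
  obtain ⟨m, rfl⟩ := Nat.exists_eq_add_of_le' hs
  rw [coeff_Fpoly_eq_coeff_chooseSeries, add_comm m 2, PowerSeries.coeff_X_pow_mul',
    if_pos (by omega)]
  simp only [chooseSeries, PowerSeries.coeff_mk, Nat.add_sub_cancel_left]
  rw [show 2 * (2 + m) - 1 = 2 * m + 3 by omega]
end
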